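/- arXiv:math/0410129 — 3 statements merged into one kernel-verified Lean document; each statement's English description precedes it below -/
import Mathlib

section
/- Let G be a finite connected simple graph, let w be a positive goal distribution on G, and let p be a distribution of pebbles on G that is not w-solvable. If p has at least one fat vertex (a vertex f with p(f) > w(f)), then there exists a fat vertex f of p such that the simple distribution placing all Σ_v p(v) pebbles on f is also not w-solvable. -/
/-- A single pebbling move on a graph `G`: remove two pebbles from a vertex `u`
(which must carry at least two pebbles) and add one pebble to a vertex `v`
adjacent to `u`. -/
def SimpleGraph.PebblingMove {V : Type*} (G : SimpleGraph V) (p q : V → ℕ) : Prop :=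
  ∃ u v : V, G.Adj u v ∧ 2 ≤ p u ∧
    q u = p u - 2 ∧ q v = p v + 1 ∧ ∀ x : V, x ≠ u → x ≠ v → q x = p x

/-- A distribution `p` is `w`-solvable if some finite sequence of pebbling moves
starting from `p` reaches a `w`-cover, i.e. a distribution `q` with `q v ≥ w v`
for every vertex `v`. -/
def SimpleGraph.WSolvable {V : Type*} (G : SimpleGraph V) (w p : V → ℕ) : Prop :=
  ∃ q : V → ℕ, Relation.ReflTransGen G.PebblingMove p q ∧ ∀ v : V, w v ≤ q v

/-- The `w`-cover pebbling number of `G`: the least `n` such that every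
distribution of size `n` (total number of pebbles `n`) is `w`-solvable. -/
noncomputable def SimpleGraph.coverPebblingNumber {V : Type*} (G : SimpleGraph V) [Fintype V]
    (w : V → ℕ) : ℕ :=
  sInf {n | ∀ p : V → ℕ, (∑ v, p v) = n → G.WSolvable w p}

namespace SimpleGraph

variable {V : Type*} {G : SimpleGraph V}

/-- The effect of a pebbling move from `u` to `v` on every weighted count of the pebbles. -/
lemma weighted_sum_of_pebbling [Fintype V] [DecidableEq V] {p q : V → ℕ} {u v : V}
    (huv : G.Adj u v) (hu : 2 ≤ p u) (hqu : q u = p u - 2) (hqv : q v = p v + 1)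
    (hq : ∀ x, x ≠ u → x ≠ v → q x = p x) (c : V → ℕ) :
    ∑ x, q x * c x + 2 * c u = ∑ x, p x * c x + c v := by
  have key : ∀ x, q x * c x + (if x = u then 2 * c x else 0)
      = p x * c x + (if x = v then c x else 0) := by
    intro x
    by_cases hxu : x = u
    · subst hxu
      simp only [if_true, if_neg huv.ne, hqu, ← add_mul, add_zero]
      congr 1
      omega
    · by_cases hxv : x = v
      · subst hxv
        simp [hxu, hqv, add_mul]
      · simp [hxu, hxv, hq x hxu hxv]
  have := Finset.sum_congr (rfl : (Finset.univ : Finset V) = Finset.univ) fun x _ => key x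
  simpa [Finset.sum_add_distrib] using this

/-- The distribution obtained from `p` by a pebbling move from `u` to `v`. -/
lemma Adj.exists_pebbling [DecidableEq V] {u v : V} (huv : G.Adj u v) (p : V → ℕ) :
    ∃ q : V → ℕ, q u = p u - 2 ∧ q v = p v + 1 ∧ ∀ x, x ≠ u → x ≠ v → q x = p x :=
  ⟨fun x => if x = u then p u - 2 else if x = v then p v + 1 else p x,
    by simp, by simp [huv.ne'], fun x hxu hxv => by simp [hxu, hxv]⟩

/-- The number of pebbles weighted by `2 ^ dist f x` never increases. -/
lemma sum_mul_two_pow_dist_le [Fintype V] [DecidableEq V] (hG : G.Connected) (f : V)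
    {p q : V → ℕ} (h : Relation.ReflTransGen G.PebblingMove p q) :
    ∑ x, q x * 2 ^ G.dist f x ≤ ∑ x, p x * 2 ^ G.dist f x := by
  induction h with
  | refl => exact le_rfl
  | tail _ hmove ih =>
    obtain ⟨u, v, huv, hu, hqu, hqv, hq⟩ := hmove
    have hsum := weighted_sum_of_pebbling huv hu hqu hqv hq fun x => 2 ^ G.dist f x
    have hdist : G.dist f v ≤ G.dist f u + 1 :=
      hG.dist_triangle.trans_eq (by rw [dist_eq_one_iff_adj.2 huv])
    have hpow : 2 ^ G.dist f v ≤ 2 ^ (G.dist f u + 1) := Nat.pow_le_pow_right two_pos hdist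
    rw [pow_succ] at hpow
    omega

/-- The distance from a nonempty finite set of vertices to a vertex. -/
noncomputable def distFrom (G : SimpleGraph V) (F : Finset V) (hF : F.Nonempty) (x : V) : ℕ :=
  F.inf' hF fun f => G.dist f x

lemma distFrom_le {F : Finset V} (hF : F.Nonempty) {f : V} (hf : f ∈ F) (x : V) :
    G.distFrom F hF x ≤ G.dist f x :=
  Finset.inf'_le _ hf

lemma distFrom_anti {F F' : Finset V} (hF : F.Nonempty) (hF' : F'.Nonempty) (h : F' ⊆ F)
    (x : V) : G.distFrom F hF x ≤ G.distFrom F' hF' x :=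
  Finset.inf'_mono _ h hF'

lemma exists_mem_distFrom_eq {F : Finset V} (hF : F.Nonempty) (x : V) :
    ∃ f ∈ F, G.distFrom F hF x = G.dist f x :=
  Finset.exists_mem_eq_inf' hF _

lemma distFrom_eq_zero_iff (hG : G.Connected) {F : Finset V} (hF : F.Nonempty) {x : V} :
    G.distFrom F hF x = 0 ↔ x ∈ F := by
  constructor
  · intro h
    obtain ⟨f, hf, hfx⟩ := exists_mem_distFrom_eq (G := G) hF x
    rw [h, eq_comm, hG.dist_eq_zero_iff] at hfx
    exact hfx ▸ hf
  · intro h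
    simpa using distFrom_le (G := G) hF h x

lemma exists_adj_distFrom_eq (hG : G.Connected) {F : Finset V} (hF : F.Nonempty) {t : V} {n : ℕ}
    (ht : G.distFrom F hF t = n + 1) : ∃ v, G.Adj v t ∧ G.distFrom F hF v = n := by
  obtain ⟨f, hf, hft⟩ := exists_mem_distFrom_eq (G := G) hF t
  obtain ⟨W, hW⟩ := hG.exists_walk_length_eq_dist t f
  cases W with
  | nil => simp [ht] at hft
  | @cons _ v _ hadj W =>
    refine ⟨v, hadj.symm, ?_⟩
    have hle : G.distFrom F hF v ≤ W.length :=
      (distFrom_le hF hf v).trans (dist_comm (G := G) ▸ dist_le W)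
    obtain ⟨g, hg, hgv⟩ := exists_mem_distFrom_eq (G := G) hF v
    have htri : G.dist g t ≤ G.dist g v + G.dist v t := hG.dist_triangle
    have hgt := distFrom_le (G := G) hF hg t
    rw [dist_eq_one_iff_adj.2 hadj.symm] at htri
    rw [Walk.length_cons, dist_comm] at hW
    omega

/-- If every vertex of `F` is fat and the vertices outside `F` closer to `F` than `t` are not
thin, then an extra pebble can be brought to `t` without making any other vertex richer and
without changing the number of pebbles weighted by `2 ^ distFrom F x`. -/
lemma exists_pebbling_add_one [Fintype V] [DecidableEq V] (hG : G.Connected) {w q : V → ℕ}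
    (hw : ∀ v, 1 ≤ w v) {F : Finset V} (hF : F.Nonempty) (hfat : ∀ f ∈ F, w f < q f) (n : ℕ)
    (t : V) (ht : G.distFrom F hF t = n + 1) (hq : ∀ x, G.distFrom F hF x ≤ n → w x ≤ q x) :
    ∃ q', Relation.ReflTransGen G.PebblingMove q q' ∧ q' t = q t + 1 ∧
      (∀ x, x ≠ t → q' x ≤ q x) ∧
      (∀ x, x ≠ t → G.distFrom F hF t ≤ G.distFrom F hF x → q' x = q x) ∧
      ∑ x, q' x < ∑ x, q x ∧
      ∑ x, q' x * 2 ^ G.distFrom F hF x = ∑ x, q x * 2 ^ G.distFrom F hF x := by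
  have step : ∀ {v t : V} {q₁ : V → ℕ}, G.Adj v t →
      G.distFrom F hF t = G.distFrom F hF v + 1 →
      Relation.ReflTransGen G.PebblingMove q q₁ → 2 ≤ q₁ v → q₁ v ≤ q v + 1 →
      (∀ x, x ≠ v → q₁ x ≤ q x) →
      (∀ x, x ≠ v → G.distFrom F hF v ≤ G.distFrom F hF x → q₁ x = q x) →
      ∑ x, q₁ x ≤ ∑ x, q x →
      ∑ x, q₁ x * 2 ^ G.distFrom F hF x = ∑ x, q x * 2 ^ G.distFrom F hF x →
      ∃ q', Relation.ReflTransGen G.PebblingMove q q' ∧ q' t = q t + 1 ∧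
        (∀ x, x ≠ t → q' x ≤ q x) ∧
        (∀ x, x ≠ t → G.distFrom F hF t ≤ G.distFrom F hF x → q' x = q x) ∧
        ∑ x, q' x < ∑ x, q x ∧
        ∑ x, q' x * 2 ^ G.distFrom F hF x = ∑ x, q x * 2 ^ G.distFrom F hF x := by
    intro v t q₁ hvt hD hreach hv hv' hle heq hsum hpot
    obtain ⟨q', hq'v, hq't, hq'⟩ := hvt.exists_pebbling q₁
    have hmove : G.PebblingMove q₁ q' := ⟨v, t, hvt, hv, hq'v, hq't, hq'⟩
    have hweight := weighted_sum_of_pebbling hvt hv hq'v hq't hq'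
    refine ⟨q', hreach.tail hmove, ?_, fun x hxt => ?_, fun x hxt hx => ?_, ?_, ?_⟩
    · rw [hq't, heq t hvt.ne' (by omega)]
    · by_cases hxv : x = v
      · subst hxv
        omega
      · exact (hq' x hxv hxt).trans_le (hle x hxv)
    · have hxv : x ≠ v := by
        rintro rfl
        omega
      rw [hq' x hxv hxt, heq x hxv (by omega)]
    · have h1 := hweight fun _ => 1
      simp only [mul_one] at h1
      omega
    · have h2 := hweight fun x => 2 ^ G.distFrom F hF x
      simp only [hD, pow_succ] at h2
      omega
  induction n generalizing t with
  | zero =>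
    obtain ⟨v, hvt, hv⟩ := exists_adj_distFrom_eq hG hF ht
    have hqv := hfat v ((distFrom_eq_zero_iff hG hF).1 hv)
    have hwv := hw v
    exact step hvt (by omega) .refl (by omega) (by omega) (fun _ _ => le_rfl)
      (fun _ _ _ => rfl) le_rfl rfl
  | succ n ih =>
    obtain ⟨v, hvt, hv⟩ := exists_adj_distFrom_eq hG hF ht
    obtain ⟨q₁, hreach, hq₁v, hle, heq, hsum, hpot⟩ := ih v hv fun x hx => hq x (by omega)
    have hqv := hq v hv.le
    have hwv := hw v
    exact step hvt (by omega) hreach (by omega) hq₁v.le hle heq hsum.le hpot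

/-- Among the fat vertices of an unsolvable distribution there is one, `f`, for which the pebbles
weighted by their distances to the fat vertices count less than the goal weighted by the distances
to `f`. -/
lemma exists_fat_sum_lt [Fintype V] [DecidableEq V] (hG : G.Connected) {w : V → ℕ}
    (hw : ∀ v, 1 ≤ w v) (N : ℕ) (q : V → ℕ) (hN : ∑ x, q x = N) (hq : ¬ G.WSolvable w q)
    (hF : (Finset.univ.filter fun x => w x < q x).Nonempty) :
    ∃ f, w f < q f ∧
      ∑ x, q x * 2 ^ G.distFrom (Finset.univ.filter fun x => w x < q x) hF x
        < ∑ x, w x * 2 ^ G.dist f x := by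
  induction N using Nat.strong_induction_on generalizing q with
  | _ N ih =>
    set F := Finset.univ.filter fun x => w x < q x with hFdef
    have hmem : ∀ x, x ∈ F ↔ w x < q x := by simp [hFdef]
    have hthin : (Finset.univ.filter fun x => q x < w x).Nonempty := by
      by_contra hcon
      refine hq ⟨q, .refl, fun v => ?_⟩
      by_contra hv
      exact hcon ⟨v, by simpa using hv⟩
    obtain ⟨t, ht, hmin⟩ := Finset.exists_min_image _ (G.distFrom F hF) hthin
    simp only [Finset.mem_filter, Finset.mem_univ, true_and] at ht hmin
    have hDt : G.distFrom F hF t ≠ 0 := by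
      rw [Ne, distFrom_eq_zero_iff hG hF, hmem]
      omega
    obtain ⟨n, hn⟩ := Nat.exists_eq_succ_of_ne_zero hDt
    obtain ⟨q', hreach, hq't, hle, -, hsum, hpot⟩ :=
      exists_pebbling_add_one hG hw hF (fun f hf => (hmem f).1 hf) n t hn fun x hx => by
        by_contra hcon
        have := hmin x (by omega)
        omega
    have hq' : ¬ G.WSolvable w q' := fun ⟨r, hr, hwr⟩ => hq ⟨r, hreach.trans hr, hwr⟩
    have hfat : ∀ x, w x < q' x → w x < q x := by
      intro x hx
      by_cases hxt : x = t
      · subst hxt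
        omega
      · exact hx.trans_le (hle x hxt)
    rw [← hpot]
    by_cases hF' : (Finset.univ.filter fun x => w x < q' x).Nonempty
    · obtain ⟨f, hf, hlt⟩ := ih _ (hN ▸ hsum) q' rfl hq' hF'
      refine ⟨f, hfat f hf, lt_of_le_of_lt (Finset.sum_le_sum fun x _ => ?_) hlt⟩
      refine Nat.mul_le_mul_left _ (Nat.pow_le_pow_right two_pos (distFrom_anti hF hF' ?_ x))
      intro y hy
      simp only [Finset.mem_filter, Finset.mem_univ, true_and] at hy
      exact (hmem y).2 (hfat y hy)
    · have hle' : ∀ x, q' x ≤ w x := by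
        intro x
        by_contra hx
        exact hF' ⟨x, by simpa using hx⟩
      obtain ⟨v, hv⟩ : ∃ v, q' v < w v := by
        by_contra! hcon
        exact hq' ⟨q', .refl, hcon⟩
      obtain ⟨f, hf⟩ := hF
      have hD : ∀ x, 2 ^ G.distFrom F ⟨f, hf⟩ x ≤ 2 ^ G.dist f x := fun x =>
        Nat.pow_le_pow_right two_pos (distFrom_le _ hf x)
      exact ⟨f, (hmem f).1 hf, Finset.sum_lt_sum (fun x _ => Nat.mul_le_mul (hle' x) (hD x))
        ⟨v, Finset.mem_univ v, Nat.mul_lt_mul_of_lt_of_le hv (hD v) (by positivity)⟩⟩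

end SimpleGraph

/-- If a distribution `p` is not `w`-solvable and has a fat vertex (a vertex `f`
with `p f > w f`), then all pebbles of `p` may be concentrated on one of the fat
vertices with `w`-solvability still failing. -/
theorem concentrate_on_fat_vertex {V : Type*} [Fintype V] [DecidableEq V]
    (G : SimpleGraph V) (hG : G.Connected) (w : V → ℕ) (hw : ∀ v : V, 1 ≤ w v)
    (p : V → ℕ) (hp : ¬ G.WSolvable w p) (hfat : ∃ f : V, w f < p f) :
    ∃ f : V, w f < p f ∧
      ¬ G.WSolvable w (fun x => if x = f then ∑ v : V, p v else 0) := by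
  have hF : (Finset.univ.filter fun x => w x < p x).Nonempty := by
    obtain ⟨f, hf⟩ := hfat
    exact ⟨f, by simpa using hf⟩
  obtain ⟨f, hf, hlt⟩ := SimpleGraph.exists_fat_sum_lt hG hw _ p rfl hp hF
  refine ⟨f, hf, fun ⟨r, hr, hwr⟩ => ?_⟩
  have hbound := SimpleGraph.sum_mul_two_pow_dist_le hG f hr
  have hgoal : ∑ x, w x * 2 ^ G.dist f x ≤ ∑ x, r x * 2 ^ G.dist f x :=
    Finset.sum_le_sum fun x _ => Nat.mul_le_mul_right _ (hwr x)
  have hsize : ∑ x, p x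
      ≤ ∑ x, p x * 2 ^ G.distFrom (Finset.univ.filter fun x => w x < p x) hF x :=
    Finset.sum_le_sum fun x _ => Nat.le_mul_of_pos_right _ (by positivity)
  simp only [ite_mul, zero_mul, Finset.sum_ite_eq', Finset.mem_univ, if_true,
    SimpleGraph.dist_self, pow_zero, mul_one] at hbound
  omega
end

section
/- Let G₁ and G₂ be finite connected simple graphs with positive goal distributions w₁ and w₂ respectively, and let w₁□w₂ be the goal distribution on the box product G₁□G₂ defined by (w₁□w₂)(v₁,v₂) = w₁(v₁)·w₂(v₂). Then the cover pebbling numbers satisfy γ_{w₁□w₂}(G₁□G₂) = γ_{w₁}(G₁)·γ_{w₂}(G₂). -/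
namespace SimpleGraph

variable {V : Type*} {G : SimpleGraph V}

/-- The number of pebbles needed to solve the goal `w` starting from a stack on `v`. -/
noncomputable def stackingNumber [Fintype V] (G : SimpleGraph V) (w : V → ℕ) (v : V) : ℕ :=
  ∑ u, w u * 2 ^ G.dist u v

/-- The potential of a distribution `p`: surplus pebbles count once, while a pebble meeting the
demand of `w` at `u` counts `2 ^ D u` times. -/
def pebblingPotential [Fintype V] (w D p : V → ℕ) : ℕ :=
  ∑ u, ((p u - w u) + min (w u) (p u) * 2 ^ D u)

theorem sum_eq_add_sub_of_eq_off_pair [Fintype V] {P F : V → ℕ} {x y : V} (hxy : x ≠ y)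
    (h : ∀ u, u ≠ x → u ≠ y → F u = P u) :
    ((∑ u, F u : ℕ) : ℤ) = (∑ u, P u : ℕ) + ((F x : ℤ) - P x) + ((F y : ℤ) - P y) := by
  have := Finset.sum_eq_add (s := Finset.univ) (f := fun u => (F u : ℤ) - P u) x y hxy
    (fun c _ hc => by simp [h c hc.1 hc.2]) (by simp) (by simp)
  rw [Finset.sum_sub_distrib] at this
  push_cast
  linarith

theorem sum_mul_two_pow_dist_le_of_pebblingMove [Fintype V] (hG : G.Connected) {p q : V → ℕ}
    (v : V) (h : G.PebblingMove p q) :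
    ∑ u, q u * 2 ^ G.dist u v ≤ ∑ u, p u * 2 ^ G.dist u v := by
  obtain ⟨x, y, hxy, hx, hqx, hqy, hq⟩ := h
  have hsum := sum_eq_add_sub_of_eq_off_pair (P := fun u => p u * 2 ^ G.dist u v)
    (F := fun u => q u * 2 ^ G.dist u v) hxy.ne (fun u h₁ h₂ => by simp [hq u h₁ h₂])
  have hd : G.dist y v ≤ G.dist x v + 1 := by
    have h₁ := hG.dist_triangle (u := y) (v := x) (w := v)
    rw [dist_eq_one_iff_adj.2 hxy.symm] at h₁
    omega
  have hpow : (2 : ℤ) ^ G.dist y v ≤ 2 * 2 ^ G.dist x v := by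
    rw [← pow_succ']
    exact pow_le_pow_right₀ (by norm_num) hd
  simp only [hqx, hqy] at hsum
  push_cast [hx] at hsum
  zify
  nlinarith

theorem stackingNumber_le_of_wSolvable [Fintype V] [DecidableEq V] (hG : G.Connected)
    {w : V → ℕ} {v : V} {n : ℕ} (h : G.WSolvable w (Pi.single v n)) :
    G.stackingNumber w v ≤ n := by
  obtain ⟨q, hq, hcov⟩ := h
  have hle : ∑ u, q u * 2 ^ G.dist u v ≤
      ∑ u, (Pi.single v n : V → ℕ) u * 2 ^ G.dist u v := by
    clear hcov
    induction hq with
    | refl => exact le_rfl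
    | tail _ hm ih => exact (sum_mul_two_pow_dist_le_of_pebblingMove hG v hm).trans ih
  have hn : ∑ u, (Pi.single v n : V → ℕ) u * 2 ^ G.dist u v = n := by
    rw [Finset.sum_eq_single v] <;> simp +contextual
  calc G.stackingNumber w v ≤ ∑ u, q u * 2 ^ G.dist u v :=
        Finset.sum_le_sum fun u _ => Nat.mul_le_mul_right _ (hcov u)
    _ ≤ n := hn ▸ hle

theorem WSolvable.of_reflTransGen {w p q : V → ℕ}
    (h : Relation.ReflTransGen G.PebblingMove p q) (hq : G.WSolvable w q) : G.WSolvable w p := by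
  obtain ⟨r, hr, hcov⟩ := hq
  exact ⟨r, h.trans hr, hcov⟩

/-- Pushing pebbles along a path from a vertex with surplus to a vertex with deficit, using at
each inner vertex one of its own pebbles. -/
theorem exists_reachable_pushAlong [Fintype V] {w D : V → ℕ} (hw : ∀ v, 1 ≤ w v)
    (hD : ∀ u v, G.Adj u v → D v ≤ D u + 1) {x t : V} (c : G.Walk x t) :
    ∀ (p : V → ℕ) (j : ℕ), c.IsPath → x ≠ t → w x < p x → p t < w t →
      (∀ u ∈ c.support, u ≠ t → w u ≤ p u) → D x ≤ j → j + c.length ≤ D t →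
      ∃ q : V → ℕ, Relation.ReflTransGen G.PebblingMove p q ∧ q x + 2 ≤ p x ∧ q t ≤ p t + 1 ∧
        (∀ u, u ≠ t → q u ≤ p u) ∧ ∑ u, q u < ∑ u, p u ∧
        pebblingPotential w D p + 2 ^ j ≤ pebblingPotential w D q + 1 := by
  classical
  induction c with
  | nil => intro p j _ h; exact absurd rfl h
  | @cons x y t hxy c ih =>
    intro p j hpath hxt hx ht hsupp hDx hDt
    obtain ⟨hc, hxc⟩ := (Walk.cons_isPath_iff hxy c).1 hpath
    have hwx := hw x
    let q : V → ℕ := fun u => if u = x then p x - 2 else if u = y then p y + 1 else p u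
    have hqx : q x = p x - 2 := by simp [q]
    have hqy : q y = p y + 1 := by simp [q, hxy.ne']
    have hq : ∀ u, u ≠ x → u ≠ y → q u = p u := fun u h₁ h₂ => by simp [q, h₁, h₂]
    have hmove : G.PebblingMove p q := ⟨x, y, hxy, by omega, hqx, hqy, hq⟩
    have hsum := sum_eq_add_sub_of_eq_off_pair hxy.ne hq
    have hpot : (pebblingPotential w D q : ℤ) = pebblingPotential w D p + _ + _ :=
      sum_eq_add_sub_of_eq_off_pair (P := fun u => (p u - w u) + min (w u) (p u) * 2 ^ D u)
      (F := fun u => (q u - w u) + min (w u) (q u) * 2 ^ D u) hxy.ne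
      (fun u h₁ h₂ => by simp [hq u h₁ h₂])
    have hlossx : p x - w x + min (w x) (p x) * 2 ^ D x ≤
        q x - w x + min (w x) (q x) * 2 ^ D x + 1 + 2 ^ j := by
      have hpow : 2 ^ D x ≤ 2 ^ j := Nat.pow_le_pow_right (by norm_num) hDx
      rw [hqx, min_eq_left hx.le]
      rcases Nat.lt_or_ge (p x) (w x + 2) with h | h
      · have hpx : p x = w x + 1 := by omega
        obtain ⟨k, hk⟩ : ∃ k, w x = k + 1 := ⟨w x - 1, by omega⟩
        rw [hpx, hk, min_eq_right (by omega), show k + 1 + 1 - 2 = k by omega, add_mul]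
        omega
      · have := Nat.one_le_two_pow (n := j)
        rw [min_eq_left (by omega)]
        omega
    by_cases hyt : y = t
    · subst hyt
      have hgain : q y - w y + min (w y) (q y) * 2 ^ D y =
          p y - w y + min (w y) (p y) * 2 ^ D y + 2 ^ D y := by
        rw [hqy, min_eq_right (by omega), min_eq_right (by omega), add_mul]
        omega
      have hpow : 2 ^ (j + 1) ≤ 2 ^ D y :=
        Nat.pow_le_pow_right (by norm_num) (by simp at hDt; omega)
      rw [pow_succ] at hpow
      refine ⟨q, .single hmove, by omega, by omega, fun u hu => ?_, by omega, by omega⟩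
      by_cases hux : u = x
      · subst hux; omega
      · exact (hq u hux hu).le
    · have htx : t ≠ x := hxt.symm
      have hqt : q t = p t := hq t htx (Ne.symm hyt)
      have hpy : w y ≤ p y := hsupp y (by simp) hyt
      have hgain : q y - w y + min (w y) (q y) * 2 ^ D y =
          p y - w y + min (w y) (p y) * 2 ^ D y + 1 := by
        rw [hqy, min_eq_left (by omega), min_eq_left (by omega)]
        omega
      obtain ⟨r, hqr, hry, hrt, hr, hrs, hrpot⟩ := ih q (j + 1) hc hyt (by omega) (by omega)
        (fun u hu hut => by
          have hux : u ≠ x := fun h => hxc (h ▸ hu)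
          have := hsupp u (by simp [hu]) hut
          by_cases huy : u = y
          · subst huy; omega
          · rw [hq u hux huy]; exact this)
        ((hD x y hxy).trans (by omega)) (by simp at hDt; omega)
      have hrx := hr x hxt
      rw [pow_succ] at hrpot
      refine ⟨r, hqr.head hmove, by omega, by omega, fun u hu => ?_, by omega, by omega⟩
      by_cases hux : u = x
      · subst hux; omega
      by_cases huy : u = y
      · subst huy; omega
      · rw [← hq u hux huy]; exact hr u hu

theorem exists_pebblingPotential_lt_stackingNumber [Fintype V] (hG : G.Connected)
    {w : V → ℕ} (hw : ∀ v, 1 ≤ w v) (p D : V → ℕ) (hp : ¬ G.WSolvable w p)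
    (hfat : ∀ v, w v < p v → ∀ u, D u ≤ G.dist u v) (hD : ∃ v, ∀ u, D u ≤ G.dist u v) :
    ∃ v, pebblingPotential w D p < G.stackingNumber w v := by
  classical
  induction hn : ∑ u, p u using Nat.strong_induction_on generalizing p D with
  | _ n ih =>
  obtain ⟨t₀, ht₀⟩ : ∃ t, p t < w t := by
    by_contra! h
    exact hp ⟨p, .refl, h⟩
  let F : Finset V := {v | w v < p v}
  have hF : ∀ {v}, v ∈ F ↔ w v < p v := by simp [F]
  rcases F.eq_empty_or_nonempty with hemp | hne
  · obtain ⟨v, hv⟩ := hD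
    have hle : ∀ u, p u ≤ w u := fun u => by
      by_contra! h
      simpa [hemp] using hF.2 h
    refine ⟨v, Finset.sum_lt_sum (fun u _ => ?_) ⟨t₀, Finset.mem_univ _, ?_⟩⟩
    · rw [Nat.sub_eq_zero_of_le (hle u), zero_add, min_eq_right (hle u)]
      exact Nat.mul_le_mul (hle u) (Nat.pow_le_pow_right (by norm_num) (hv u))
    · rw [Nat.sub_eq_zero_of_le (hle t₀), zero_add, min_eq_right (hle t₀)]
      exact Nat.mul_lt_mul_of_lt_of_le ht₀ (Nat.pow_le_pow_right (by norm_num) (hv t₀))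
        (by positivity)
  · let E : V → ℕ := fun u => F.inf' hne (G.dist u)
    have hE : ∀ u, ∀ v ∈ F, E u ≤ G.dist u v := fun u v hv => Finset.inf'_le _ hv
    have hE' : ∀ u, ∃ v ∈ F, E u = G.dist u v := fun u => Finset.exists_mem_eq_inf' hne _
    have hDE : ∀ u, D u ≤ E u := fun u => by
      obtain ⟨v, hv, h⟩ := hE' u
      exact h ▸ hfat v (hF.1 hv) u
    have hadj : ∀ u v, G.Adj u v → E v ≤ E u + 1 := fun u v huv => by
      obtain ⟨z, hz, h⟩ := hE' u
      have h₁ := hG.dist_triangle (u := v) (v := u) (w := z)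
      rw [dist_eq_one_iff_adj.2 huv.symm] at h₁
      have := hE v z hz
      omega
    obtain ⟨t, ht, hmin⟩ := Finset.exists_min_image ({t | p t < w t} : Finset V) E
      ⟨t₀, by simpa using ht₀⟩
    simp only [Finset.mem_filter, Finset.mem_univ, true_and] at ht hmin
    obtain ⟨f, hf, hft⟩ := hE' t
    have hpf := hF.1 hf
    obtain ⟨c, hc, hlen⟩ := hG.exists_path_of_dist f t
    obtain ⟨q, hpq, -, hqt, hq, hqs, hpot⟩ := exists_reachable_pushAlong hw hadj c p 0 hc
      (by rintro rfl; omega) hpf ht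
      (fun u hu hut => by
        by_contra! hlt
        have h₁ := hmin u hlt
        have h₂ := hE u f hf
        have h₃ := dist_le (c.takeUntil u hu)
        have h₄ := c.length_takeUntil_lt_length hu hut
        rw [dist_comm] at h₃ hft
        omega)
      ((hE f f hf).trans (by simp)) (by rw [hft, dist_comm]; omega)
    have hqfat : ∀ v, w v < q v → v ∈ F := fun v hv => hF.2 (by
      by_cases hvt : v = t
      · subst hvt; omega
      · exact hv.trans_le (hq v hvt))
    obtain ⟨v, hv⟩ := ih _ (hn ▸ hqs) q E (fun h => hp (.of_reflTransGen hpq h))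
      (fun v hv u => hE u v (hqfat v hv)) ⟨f, fun u => hE u f hf⟩ rfl
    have hmono : pebblingPotential w D p ≤ pebblingPotential w E p :=
      Finset.sum_le_sum fun u _ => Nat.add_le_add_left
        (Nat.mul_le_mul_left _ (Nat.pow_le_pow_right (by norm_num) (hDE u))) _
    exact ⟨v, by omega⟩

/-- The cover pebbling theorem: for positive goals, stacked distributions are the worst ones. -/
theorem isGreatest_coverPebblingNumber [Fintype V] (hG : G.Connected) {w : V → ℕ}
    (hw : ∀ v, 1 ≤ w v) :
    IsGreatest (Set.range (G.stackingNumber w)) (G.coverPebblingNumber w) := by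
  classical
  have := hG.nonempty
  obtain ⟨v, hv⟩ := Finite.exists_max (G.stackingNumber w)
  have hmem : ∀ p : V → ℕ, ∑ u, p u = G.stackingNumber w v → G.WSolvable w p := by
    intro p hp
    by_contra hns
    obtain ⟨v', hv'⟩ := exists_pebblingPotential_lt_stackingNumber hG hw p 0 hns
      (by simp) ⟨v, by simp⟩
    have hpot : pebblingPotential w 0 p = ∑ u, p u :=
      Finset.sum_congr rfl fun u _ => by simp only [Pi.zero_apply, pow_zero, mul_one]; omega
    have := hv v'
    omega
  have hub : ∀ v', G.stackingNumber w v' ≤ G.coverPebblingNumber w := fun v' =>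
    stackingNumber_le_of_wSolvable hG
      (Nat.sInf_mem (s := {n | ∀ p : V → ℕ, (∑ v, p v) = n → G.WSolvable w p}) ⟨_, hmem⟩
        (Pi.single v' _) (by simp [coverPebblingNumber]))
  refine ⟨⟨v, (hub v).antisymm (Nat.sInf_le hmem)⟩, ?_⟩
  rintro _ ⟨v', rfl⟩
  exact hub v'

theorem stackingNumber_boxProd {V₁ V₂ : Type*} [Fintype V₁] [Fintype V₂]
    {G₁ : SimpleGraph V₁} {G₂ : SimpleGraph V₂} (hG₁ : G₁.Connected) (hG₂ : G₂.Connected)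
    (w₁ : V₁ → ℕ) (w₂ : V₂ → ℕ) (v : V₁ × V₂) :
    (G₁ □ G₂).stackingNumber (fun x => w₁ x.1 * w₂ x.2) v =
      G₁.stackingNumber w₁ v.1 * G₂.stackingNumber w₂ v.2 := by
  have hdist : ∀ x, (G₁ □ G₂).dist x v = G₁.dist x.1 v.1 + G₂.dist x.2 v.2 := fun x => by
    have h := edist_boxProd (G := G₁) (H := G₂) x v
    rw [← ((hG₁.boxProd hG₂).preconnected x v).coe_dist_eq_edist,
      ← (hG₁.preconnected x.1 v.1).coe_dist_eq_edist,
      ← (hG₂.preconnected x.2 v.2).coe_dist_eq_edist] at h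
    exact_mod_cast h
  simp only [stackingNumber, hdist, Finset.sum_mul_sum, Fintype.sum_prod_type]
  exact Finset.sum_congr rfl fun _ _ => Finset.sum_congr rfl fun _ _ => by ring

end SimpleGraph

/-- The cover pebbling number of a box product is the product of the cover
pebbling numbers: `γ_{w₁□w₂}(G₁□G₂) = γ_{w₁}(G₁) · γ_{w₂}(G₂)`. -/
theorem coverPebblingNumber_boxProd {V₁ V₂ : Type*} [Fintype V₁] [Fintype V₂]
    (G₁ : SimpleGraph V₁) (G₂ : SimpleGraph V₂)
    (hG₁ : G₁.Connected) (hG₂ : G₂.Connected)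
    (w₁ : V₁ → ℕ) (w₂ : V₂ → ℕ) (hw₁ : ∀ v : V₁, 1 ≤ w₁ v) (hw₂ : ∀ v : V₂, 1 ≤ w₂ v) :
    (G₁ □ G₂).coverPebblingNumber (fun x : V₁ × V₂ => w₁ x.1 * w₂ x.2) =
      G₁.coverPebblingNumber w₁ * G₂.coverPebblingNumber w₂ := by
  have hw : ∀ v : V₁ × V₂, 1 ≤ w₁ v.1 * w₂ v.2 := fun v => Nat.mul_pos (hw₁ v.1) (hw₂ v.2)
  obtain ⟨⟨v, hv⟩, hub⟩ :=
    SimpleGraph.isGreatest_coverPebblingNumber (hG₁.boxProd hG₂) hw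
  obtain ⟨⟨v₁, hv₁⟩, hub₁⟩ := SimpleGraph.isGreatest_coverPebblingNumber hG₁ hw₁
  obtain ⟨⟨v₂, hv₂⟩, hub₂⟩ := SimpleGraph.isGreatest_coverPebblingNumber hG₂ hw₂
  apply le_antisymm
  · rw [← hv, SimpleGraph.stackingNumber_boxProd hG₁ hG₂]
    exact Nat.mul_le_mul (hub₁ ⟨v.1, rfl⟩) (hub₂ ⟨v.2, rfl⟩)
  · rw [← hv₁, ← hv₂, ← SimpleGraph.stackingNumber_boxProd hG₁ hG₂ w₁ w₂ (v₁, v₂)]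
    exact hub ⟨(v₁, v₂), rfl⟩
end

section
/- For n ≥ 2, the cover pebbling number of the cycle graph on 2n vertices equals 3·(2^n − 1). -/
namespace SimpleGraph

section Pebbling

variable {V : Type*} {G : SimpleGraph V}

/-- Along an edge from `u` to `v` one can perform `k` consecutive pebbling moves whenever `u`
carries at least `2 * k` pebbles. -/
theorem reflTransGen_pebblingMove_of_adj [DecidableEq V] {u v : V} (h : G.Adj u v) (k : ℕ) :
    ∀ p : V → ℕ, 2 * k ≤ p u →
      Relation.ReflTransGen G.PebblingMove p
        (fun x => if x = u then p x - 2 * k else if x = v then p x + k else p x) := by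
  have hne : v ≠ u := h.ne'
  induction k with
  | zero =>
    intro p _
    convert Relation.ReflTransGen.refl using 1
    funext x
    split_ifs <;> simp
  | succ k ih =>
    intro p hp
    refine (ih p (by omega)).tail ⟨u, v, h, ?_, ?_, ?_, ?_⟩
    · simp only [if_true]; omega
    · simp only [if_true]; omega
    · simp only [if_neg hne, if_true]; omega
    · intro x hxu hxv
      simp [hxu, hxv]

/-- Every vertex different from the target `t` has a neighbour closer to `t`. -/
theorem Connected.exists_adj_dist_eq (hG : G.Connected) {f t : V} {d : ℕ}
    (hd : G.dist f t = d + 1) : ∃ y, G.Adj f y ∧ G.dist y t = d := by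
  obtain ⟨w, hw⟩ := (hG f t).exists_walk_length_eq_dist
  cases w with
  | nil => simp at hd
  | cons hadj w =>
    rename_i y
    refine ⟨y, hadj, le_antisymm ?_ ?_⟩
    · have h1 := dist_le w
      simp only [Walk.length_cons] at hw
      omega
    · have h1 := hG.dist_triangle (u := f) (v := y) (w := t)
      have h2 : G.dist f y = 1 := dist_eq_one_iff_adj.2 hadj
      omega

/-- If `f` carries `s + 1` pebbles with `1 ≤ s ≤ 2 ^ dist f t`, and all other vertices on geodesics
from `f` to `t` are occupied, then a pebble can be brought to `t` at the expense of `s` pebbles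
of `f` and of one additional pebble from each vertex of a set `B` of vertices on a geodesic,
where the total value of the pebbles used is exactly `2 ^ dist f t`. -/
theorem Connected.exists_transport [DecidableEq V] (hG : G.Connected) (t : V) (d : ℕ) :
    ∀ (f : V) (s : ℕ) (q : V → ℕ), G.dist f t = d → 1 ≤ s → s ≤ 2 ^ d →
      (∀ x, x ≠ t → G.dist f x + G.dist x t = d → 1 + (if x = f then s else 0) ≤ q x) →
      ∃ (q' : V → ℕ) (B : Finset V), Relation.ReflTransGen G.PebblingMove q q' ∧
        (∀ x ∈ B, x ≠ t ∧ G.dist f x + G.dist x t = d) ∧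
        (∀ u, q' u + (if u = f then s else 0) + (if u ∈ B then 1 else 0) =
          q u + (if u = t then 1 else 0)) ∧
        s + ∑ x ∈ B, 2 ^ G.dist f x = 2 ^ d := by
  induction d with
  | zero =>
    intro f s q hd hs1 hs2 _
    have hft : f = t := (hG f t).dist_eq_zero_iff.1 hd
    obtain rfl : s = 1 := by simp at hs2; omega
    refine ⟨q, ∅, .refl, by simp, ?_, by simp⟩
    intro u
    simp [hft]
  | succ d ih =>
    intro f s q hd hs1 hs2 hq
    obtain ⟨y, hadj, hy⟩ := hG.exists_adj_dist_eq hd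
    have hfy : G.dist f y = 1 := dist_eq_one_iff_adj.2 hadj
    have hyf : y ≠ f := hadj.ne'
    have hft : f ≠ t := by
      rintro rfl
      simp at hd
    have hqf : 1 + s ≤ q f := by
      simpa using hq f hft (by simpa using hd)
    have geodesic : ∀ x, G.dist y x + G.dist x t = d →
        G.dist f x = G.dist y x + 1 ∧ G.dist f x + G.dist x t = d + 1 ∧ x ≠ f := by
      intro x hx
      have h1 := hG.dist_triangle (u := f) (v := y) (w := x)
      have h2 := hG.dist_triangle (u := f) (v := x) (w := t)
      refine ⟨by omega, by omega, ?_⟩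
      rintro rfl
      omega
    obtain ⟨k, hk⟩ : ∃ k, s = 2 * k ∨ s + 1 = 2 * k := ⟨(s + 1) / 2, by omega⟩
    rw [pow_succ] at hs2
    obtain ⟨q', B, hr, hB, hq', hsum⟩ := ih y k
      (fun x => if x = f then q x - 2 * k else if x = y then q x + k else q x) hy
      (by omega) (by omega) (by
        intro x hxt hx
        obtain ⟨_, h2, h3⟩ := geodesic x hx
        have h4 := hq x hxt h2
        simp only [if_neg h3] at h4 ⊢
        split_ifs <;> omega)
    have hfB : f ∉ B := fun h => (geodesic f (hB f h).2).2.2 rfl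
    have hreach := (reflTransGen_pebblingMove_of_adj hadj k q (by omega)).trans hr
    have hdouble : ∑ x ∈ B, 2 ^ G.dist f x = 2 * ∑ x ∈ B, 2 ^ G.dist y x := by
      rw [Finset.mul_sum]
      refine Finset.sum_congr rfl fun x hx => ?_
      rw [(geodesic x (hB x hx).2).1, pow_succ, mul_comm]
    rcases hk with hk | hk
    · refine ⟨q', B, hreach, fun x hx => ⟨(hB x hx).1, (geodesic x (hB x hx).2).2.1⟩, ?_, ?_⟩
      · intro u
        have h := hq' u
        rcases eq_or_ne u f with rfl | huf
        · simp only [if_true, if_neg hyf.symm, if_neg hfB, if_neg hft] at h ⊢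
          omega
        · simp only [if_neg huf] at h ⊢
          split_ifs at h ⊢ <;> omega
      · rw [hdouble, pow_succ]
        omega
    · refine ⟨q', insert f B, hreach, ?_, ?_, ?_⟩
      · intro x hx
        rcases Finset.mem_insert.1 hx with rfl | hx
        · exact ⟨hft, by simpa using hd⟩
        · exact ⟨(hB x hx).1, (geodesic x (hB x hx).2).2.1⟩
      · intro u
        have h := hq' u
        rcases eq_or_ne u f with rfl | huf
        · simp only [if_true, if_neg hyf.symm, if_neg hfB, if_neg hft, Finset.mem_insert,
            true_or] at h ⊢
          omega
        · simp only [huf, if_false, Finset.mem_insert, false_or] at h ⊢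
          split_ifs at h ⊢ <;> omega
      · rw [Finset.sum_insert hfB, hdouble, pow_succ]
        simp only [dist_self, pow_zero]
        omega

variable [Fintype V]

/-- The inductive form of the cover pebbling theorem. Here `a u` is the value of one pebble on the
vertex `u` (and `0` if `u` is empty), the remaining pebbles having value `1` each. -/
theorem Connected.wSolvable_of_value (hG : G.Connected) {n : ℕ}
    (hn : ∀ v, ∑ u, 2 ^ G.dist u v ≤ n) (N : ℕ) :
    ∀ q a : V → ℕ, ∑ u, (q u - 1) = N → (∀ u, q u = 0 → a u = 0) →
      (∀ f, 2 ≤ q f → ∀ u, a u ≤ 2 ^ G.dist u f) → (∃ f, ∀ u, a u ≤ 2 ^ G.dist u f) →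
      n ≤ ∑ u, (a u + (q u - 1)) → G.WSolvable (fun _ => 1) q := by
  classical
  induction N using Nat.strong_induction_on with
  | _ N ih =>
  intro q a hN ha0 hfat ⟨f₀, hf₀⟩ hV
  by_cases hthin : ∀ u, q u ≠ 0
  · exact ⟨q, .refl, fun u => Nat.one_le_iff_ne_zero.2 (hthin u)⟩
  push Not at hthin
  obtain ⟨t₀, ht₀⟩ := hthin
  have hfatex : ∃ f, 2 ≤ q f := by
    by_contra! hno
    have hlt : ∑ u, (a u + (q u - 1)) < ∑ u, 2 ^ G.dist u f₀ := by
      refine Finset.sum_lt_sum (fun u _ => ?_) ⟨t₀, Finset.mem_univ _, ?_⟩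
      · have h1 := hno u
        have h2 := hf₀ u
        omega
      · rw [ha0 t₀ ht₀, ht₀]
        simp
    have := hn f₀
    omega
  obtain ⟨f₁, hf₁⟩ := hfatex
  obtain ⟨⟨f, t⟩, hmem, hmin⟩ := Finset.exists_min_image
    (Finset.univ.filter fun x : V × V => 2 ≤ q x.1 ∧ q x.2 = 0) (fun x => G.dist x.1 x.2)
    ⟨(f₁, t₀), by simp [hf₁, ht₀]⟩
  simp only [Finset.mem_filter, Finset.mem_univ, true_and, Prod.forall] at hmem hmin
  obtain ⟨hf, ht⟩ := hmem
  have hft : f ≠ t := by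
    rintro rfl
    omega
  have inner : ∀ x, x ≠ t → G.dist f x + G.dist x t = G.dist f t → x ≠ f → q x = 1 := by
    intro x hxt hx hxf
    have h1 : 0 < G.dist x t := hG.pos_dist_of_ne hxt
    have h2 : 0 < G.dist f x := hG.pos_dist_of_ne hxf.symm
    by_contra hq1
    rcases (by omega : q x = 0 ∨ 2 ≤ q x) with h | h
    · have := hmin f x ⟨hf, h⟩
      omega
    · have := hmin x t ⟨h, ht⟩
      omega
  obtain ⟨s, hs⟩ : ∃ s, s = min (q f - 1) (2 ^ G.dist f t) := ⟨_, rfl⟩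
  have hpow : 1 ≤ 2 ^ G.dist f t := Nat.one_le_two_pow
  obtain ⟨q', B, hreach, hB, hq', hsum⟩ := hG.exists_transport t _ f s q rfl
    (by omega) (by omega) (by
      intro x hxt hx
      split_ifs with hxf
      · subst hxf
        omega
      · exact (inner x hxt hx hxf).ge)
  have htB : t ∉ B := fun h => (hB t h).1 rfl
  have hBq : ∀ x ∈ B, x ≠ f → q x = 1 := fun x hx => inner x (hB x hx).1 (hB x hx).2
  have hfB : f ∈ B → q f = s + 1 := by
    intro h
    have h1 : 1 ≤ ∑ x ∈ B, 2 ^ G.dist f x :=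
      le_trans Nat.one_le_two_pow
        (Finset.single_le_sum (f := fun x => 2 ^ G.dist f x) (fun _ _ => Nat.zero_le _) h)
    omega
  have hqt : q' t = 1 := by
    have h := hq' t
    simp only [if_neg hft.symm, if_neg htB, if_true] at h
    omega
  have hqB : ∀ x ∈ B, q' x = 0 := by
    intro x hx
    have h := hq' x
    simp only [if_pos hx, if_neg (hB x hx).1] at h
    rcases eq_or_ne x f with rfl | hxf
    · have := hfB hx
      simp only [if_true] at h
      omega
    · have := hBq x hx hxf
      omega
  have hqf : f ∉ B → q' f + s = q f := by
    intro hx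
    have h := hq' f
    simpa only [if_true, if_neg hx, if_neg hft, add_zero] using h
  have hqo : ∀ u, u ≠ f → u ≠ t → u ∉ B → q' u = q u := by
    intro u h1 h2 h3
    simpa [h1, h2, h3] using hq' u
  have hsurplus : ∀ u, (q' u - 1) + (if u = f then s else 0) = q u - 1 := by
    intro u
    rcases eq_or_ne u f with rfl | huf
    · simp only [if_true]
      by_cases huB : u ∈ B
      · rw [hqB u huB, hfB huB]
        omega
      · have := hqf huB
        omega
    · simp only [if_neg huf]
      by_cases huB : u ∈ B
      · rw [hqB u huB, hBq u huB huf]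
      · rcases eq_or_ne u t with rfl | hut
        · rw [hqt, ht]
        · rw [hqo u huf hut huB, add_zero]
  have hsurplus_sum : ∑ u, (q' u - 1) + s = ∑ u, (q u - 1) := by
    rw [← Finset.sum_congr rfl fun u _ => hsurplus u, Finset.sum_add_distrib]
    simp
  obtain ⟨a', ha'⟩ : ∃ a' : V → ℕ, a' =
      fun u => if u = t then 2 ^ G.dist f t else if u ∈ B then 0 else a u := ⟨_, rfl⟩
  have hle : ∀ g, 2 ≤ q g → ∀ u, a' u ≤ 2 ^ G.dist u g := by
    intro g hg u
    simp only [ha']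
    split_ifs with h1
    · subst h1
      rw [dist_comm (u := u)]
      exact Nat.pow_le_pow_right two_pos (hmin g u ⟨hg, ht⟩)
    · exact Nat.zero_le _
    · exact hfat g hg u
  have hval_sum : ∑ u, a' u + ∑ u ∈ B, a u = ∑ u, a u + 2 ^ G.dist f t := by
    have h : ∀ u, a' u + (if u ∈ B then a u else 0) =
        a u + (if u = t then 2 ^ G.dist f t else 0) := by
      intro u
      simp only [ha']
      rcases eq_or_ne u t with rfl | hut
      · simp [htB, ha0 u ht]
      · by_cases huB : u ∈ B <;> simp [hut, huB]
    have h2 := Finset.sum_congr (rfl : (Finset.univ : Finset V) = Finset.univ) fun u _ => h u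
    simpa [Finset.sum_add_distrib] using h2
  have hBval : ∑ u ∈ B, a u ≤ ∑ u ∈ B, 2 ^ G.dist f u :=
    Finset.sum_le_sum fun u _ => (hfat f hf u).trans_eq (by rw [dist_comm])
  obtain ⟨r, hr, hcover⟩ := ih (∑ u, (q' u - 1)) (by omega) q' a' rfl (by
      intro u hu
      simp only [ha']
      rcases eq_or_ne u t with rfl | hut
      · omega
      · by_cases huB : u ∈ B
        · simp [hut, huB]
        · simp only [if_neg hut, if_neg huB]
          rcases eq_or_ne u f with rfl | huf
          · have := hqf huB
            omega
          · exact ha0 u (by rw [← hqo u huf hut huB, hu]))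
    (fun g hg => hle g (by
      have := hsurplus g
      omega)) ⟨f, hle f hf⟩ (by
      rw [Finset.sum_add_distrib] at hV ⊢
      omega)
  exact ⟨r, hreach.trans hr, hcover⟩

/-- The cover pebbling theorem: a distribution whose size is at least the number of pebbles needed
on any single vertex admits a cover pebbling. -/
theorem Connected.wSolvable_one (hG : G.Connected) (p : V → ℕ)
    (hp : ∀ v, ∑ u, 2 ^ G.dist u v ≤ ∑ u, p u) : G.WSolvable (fun _ => 1) p := by
  obtain ⟨f⟩ := hG.nonempty
  have hle : ∀ g u, min (p u) 1 ≤ 2 ^ G.dist u g := fun g u =>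
    (min_le_right _ _).trans Nat.one_le_two_pow
  refine hG.wSolvable_of_value hp _ p (fun u => min (p u) 1) rfl ?_ (fun g _ => hle g)
    ⟨f, hle f⟩ (Finset.sum_le_sum fun u _ => ?_)
  · intro u hu
    simp [hu]
  · omega

/-- A weight which at most doubles along each edge does not increase under a pebbling move. -/
theorem PebblingMove.sum_mul_le {p q : V → ℕ} (h : G.PebblingMove p q) {c : V → ℕ}
    (hc : ∀ u v, G.Adj u v → c v ≤ 2 * c u) : ∑ x, q x * c x ≤ ∑ x, p x * c x := by
  classical
  obtain ⟨u, v, hadj, hu, hqu, hqv, hq⟩ := h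
  have key : ∀ x, q x * c x + (if x = u then 2 * c u else 0) =
      p x * c x + (if x = v then c v else 0) := by
    intro x
    rcases eq_or_ne x u with rfl | hxu
    · simp only [if_true, if_neg hadj.ne, hqu, add_zero]
      rw [← add_mul, Nat.sub_add_cancel hu]
    · rcases eq_or_ne x v with rfl | hxv
      · simp only [if_true, if_neg hxu, hqv]
        ring
      · simp [hxu, hxv, hq x hxu hxv]
  have h2 := Finset.sum_congr (rfl : (Finset.univ : Finset V) = Finset.univ) fun x _ => key x
  simp only [Finset.sum_add_distrib, Finset.sum_ite_eq', Finset.mem_univ, if_true] at h2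
  have := hc u v hadj
  omega

/-- The total weight of a solvable distribution is at least the weight of the goal, for any weight
which at most doubles along each edge. -/
theorem WSolvable.sum_mul_le {w p : V → ℕ} (h : G.WSolvable w p) {c : V → ℕ}
    (hc : ∀ u v, G.Adj u v → c v ≤ 2 * c u) : ∑ x, w x * c x ≤ ∑ x, p x * c x := by
  obtain ⟨q, hr, hw⟩ := h
  refine (Finset.sum_le_sum fun x _ => Nat.mul_le_mul_right _ (hw x)).trans ?_
  clear hw
  induction hr with
  | refl => exact le_rfl
  | tail _ hmove ih => exact (hmove.sum_mul_le hc).trans ih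

end Pebbling

theorem cycleGraph_dist_le_val_sub {m : ℕ} (k : ℕ) (v : Fin (m + 2)) :
    ∀ u : Fin (m + 2), (u - v).val = k → (cycleGraph (m + 2)).dist u v ≤ k := by
  induction k with
  | zero =>
    intro u hu
    have huv : u = v := sub_eq_zero.1 (Fin.val_eq_zero_iff.1 hu)
    simp [huv]
  | succ k ih =>
    intro u hu
    have hne : u - v ≠ 0 := fun h => by simp [h] at hu
    have h1 := ih (u - 1) (by
      rw [sub_right_comm, Fin.val_sub_one_of_ne_zero hne, hu, Nat.add_sub_cancel])
    have hconn : (cycleGraph (m + 2)).Connected := cycleGraph_connected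
    have h2 := hconn.dist_triangle (u := u) (v := u - 1) (w := v)
    have h3 : (cycleGraph (m + 2)).dist u (u - 1) = 1 := by
      rw [dist_eq_one_iff_adj, cycleGraph_adj]
      exact Or.inl (sub_sub_cancel u 1)
    omega

theorem cycleGraph_dist_le {m : ℕ} (u v : Fin (m + 2)) :
    (cycleGraph (m + 2)).dist u v ≤ min (u - v).val (m + 2 - (u - v).val) := by
  refine le_min (cycleGraph_dist_le_val_sub _ v u rfl) ?_
  have h := cycleGraph_dist_le_val_sub _ u v rfl
  rw [dist_comm, ← neg_sub u v, Fin.val_neg] at h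
  split_ifs at h <;> omega

end SimpleGraph

theorem sum_range_two_pow_min (n : ℕ) :
    ∑ i ∈ Finset.range (2 * n), 2 ^ min i (2 * n - i) = 3 * (2 ^ n - 1) := by
  have h0 : ∑ i ∈ Finset.range n, 2 ^ i = 2 ^ n - 1 := by
    simpa using Nat.geomSum_eq (le_refl 2) n
  have h1 : ∑ i ∈ Finset.range n, 2 ^ min i (n + n - i) = 2 ^ n - 1 := by
    rw [← h0]
    refine Finset.sum_congr rfl fun i hi => ?_
    rw [Finset.mem_range] at hi
    congr 1
    omega
  have h2 : ∑ i ∈ Finset.range n, 2 ^ min (n + i) (n + n - (n + i)) = 2 * (2 ^ n - 1) := by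
    rw [← h0, Finset.mul_sum, ← Finset.sum_range_reflect]
    refine Finset.sum_congr rfl fun i hi => ?_
    rw [Finset.mem_range] at hi
    rw [← pow_succ']
    congr 1
    omega
  rw [two_mul, Finset.sum_range_add, h1, h2]
  ring

/-- The cover pebbling number of the cycle graph on `2n` vertices (`n ≥ 2`) is
`3 * (2^n - 1)`. -/
theorem coverPebblingNumber_cycleGraph_even (n : ℕ) (hn : 2 ≤ n) :
    (SimpleGraph.cycleGraph (2 * n)).coverPebblingNumber (fun _ => 1) =
      3 * (2 ^ n - 1) := by
  obtain ⟨m, hm⟩ : ∃ m, 2 * n = m + 2 := ⟨2 * n - 2, by omega⟩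
  have hsum : ∑ i : Fin (m + 2), 2 ^ min i.val (m + 2 - i.val) = 3 * (2 ^ n - 1) := by
    rw [Fin.sum_univ_eq_sum_range fun i => 2 ^ min i (m + 2 - i), ← hm]
    exact sum_range_two_pow_min n
  rw [hm, ← hsum]
  refine IsLeast.csInf_eq ⟨?_, ?_⟩
  · intro p hp
    refine SimpleGraph.cycleGraph_connected.wSolvable_one p fun v => ?_
    rw [hp, ← (Equiv.subRight v).sum_comp fun i : Fin (m + 2) => 2 ^ min i.val (m + 2 - i.val)]
    exact Finset.sum_le_sum fun u _ =>
      Nat.pow_le_pow_right two_pos (SimpleGraph.cycleGraph_dist_le u v)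
  · intro k hk
    have h := (hk (Pi.single 0 k) (by simp)).sum_mul_le
      (c := fun i => 2 ^ min i.val (m + 2 - i.val)) (by
        intro u v huv
        rw [← pow_succ']
        refine Nat.pow_le_pow_right two_pos ?_
        have hu := u.isLt
        have hv := v.isLt
        have h1 := Fin.intCast_val_sub_eq_sub_add_ite u v
        have h2 := Fin.intCast_val_sub_eq_sub_add_ite v u
        rw [SimpleGraph.cycleGraph_adj'] at huv
        split_ifs at h1 h2 <;> omega)
    simpa [Pi.single_apply] using h
end
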